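/- Fix ε ∈ (0,1) and t > 0, and set Θ_t := min_{1 ≤ s ≤ t} ( (1/2)·(g_s/(1 − g_s/2))·Φ_s^* )². If Θ_t > 0 and t ≥ (2/Θ_t)·[ log( 1/(2·√(π_0^min·π_t^min)) ) + log(ε^{−1}) ], then d(0,t) ≤ ε. -/

import Mathlib

open Filter

/-- The product `P^{s,t} = P_{s+1} ⋯ P_t` (identity when `s ≥ t`). -/
noncomputable def mprod (n : ℕ) (P : ℤ → Matrix (Fin n) (Fin n) ℝ) (s t : ℤ) :
    Matrix (Fin n) (Fin n) ℝ :=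
  ((List.range (t - s).toNat).map (fun i => P (s + 1 + i))).prod

/-- `π` is the family of target distributions for the sequence `P`. -/
def IsTarget (n : ℕ) (P : ℤ → Matrix (Fin n) (Fin n) ℝ) (π : ℤ → Fin n → ℝ) : Prop :=
  ∀ t : ℤ, (∀ y, 0 ≤ π t y) ∧ (∑ y, π t y = 1) ∧
    ∀ x y, Tendsto (fun s : ℤ => mprod n P s t x y) atBot (nhds (π t y))

/-- `d(s,t) = max_x (1/2) ∑_z |P^{s,t}(x,z) − π_t(z)|`. -/
noncomputable def dTV (n : ℕ) (P : ℤ → Matrix (Fin n) (Fin n) ℝ)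
    (π : ℤ → Fin n → ℝ) (s t : ℤ) : ℝ :=
  ⨆ x : Fin n, (1 / 2) * ∑ z, |mprod n P s t x z - π t z|

/-- The stationary flow `Q_s(A,B) = ∑_{x∈A} ∑_{y∈B} π_{s-1}(x) P_s(x,y)`. -/
noncomputable def flowQ (n : ℕ) (P : ℤ → Matrix (Fin n) (Fin n) ℝ)
    (π : ℤ → Fin n → ℝ) (s : ℤ) (A B : Finset (Fin n)) : ℝ :=
  ∑ x ∈ A, ∑ y ∈ B, π (s - 1) x * P s x y

/-- `Φ_s(S) = (Q_s(S,Sᶜ) + Q_s(Sᶜ,S)) / (2 π_{s-1}(S))`. -/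
noncomputable def bigPhi (n : ℕ) (P : ℤ → Matrix (Fin n) (Fin n) ℝ)
    (π : ℤ → Fin n → ℝ) (s : ℤ) (S : Finset (Fin n)) : ℝ :=
  (flowQ n P π s S Sᶜ + flowQ n P π s Sᶜ S) / (2 * ∑ x ∈ S, π (s - 1) x)

/-- `Φ_s^* = inf{Φ_s(S) : S nonempty, π_{s-1}(S) ≤ 1/2}`. -/
noncomputable def bigPhiStar (n : ℕ) (P : ℤ → Matrix (Fin n) (Fin n) ℝ)
    (π : ℤ → Fin n → ℝ) (s : ℤ) : ℝ :=
  sInf {r | ∃ S : Finset (Fin n), S.Nonempty ∧ (∑ x ∈ S, π (s - 1) x) ≤ 1 / 2 ∧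
    r = bigPhi n P π s S}

/-- `g_s = min_z π_{s-1}(z)/π_s(z)`. -/
noncomputable def gq (n : ℕ) (π : ℤ → Fin n → ℝ) (s : ℤ) : ℝ :=
  ⨅ z : Fin n, π (s - 1) z / π s z

/-- `Θ_t = min_{1 ≤ s ≤ t} ((1/2)(g_s/(1−g_s/2))Φ_s^*)²`. -/
noncomputable def theta (n : ℕ) (P : ℤ → Matrix (Fin n) (Fin n) ℝ)
    (π : ℤ → Fin n → ℝ) (t : ℕ) : ℝ :=
  sInf {r | ∃ s : ℕ, 1 ≤ s ∧ s ≤ t ∧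
    r = ((1 / 2) * (gq n π s / (1 - gq n π s / 2)) * bigPhiStar n P π s) ^ 2}

section Cheeger

variable {V : Type*} [Fintype V] [DecidableEq V]

/-- Coarea inequality: an isoperimetric inequality for sets yields an `L¹` Sobolev inequality. -/
theorem coarea_le {p : V → ℝ} {W : V → V → ℝ} {h : ℝ} (hWs : ∀ x y, W x y = W y x)
    (hp : ∀ x, 0 < p x)
    (hiso : ∀ S : Finset V, ∑ x ∈ S, p x ≤ 1 / 2 →
      h * ∑ x ∈ S, p x ≤ ∑ x ∈ S, ∑ y ∈ Sᶜ, W x y)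
    (F : V → ℝ) (hF : ∀ x, 0 ≤ F x) (hsupp : ∑ x with F x ≠ 0, p x ≤ 1 / 2) :
    h * ∑ x, p x * F x ≤ 1 / 2 * ∑ x, ∑ y, W x y * |F x - F y| := by
  induction hk : (Finset.univ.filter fun x => F x ≠ 0).card using Nat.strong_induction_on
    generalizing F with
  | _ k ih =>
  set S : Finset V := Finset.univ.filter fun x => F x ≠ 0 with hS
  have hSmem : ∀ x, x ∈ S ↔ F x ≠ 0 := fun x => by simp [hS]
  rcases S.eq_empty_or_nonempty with hemp | hne
  · have h0 : ∀ x, F x = 0 := fun x => by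
      by_contra hx
      have := (hSmem x).2 hx
      simp [hemp] at this
    simp [h0]
  obtain ⟨a, haS, ha⟩ := S.exists_min_image F hne
  set m := F a
  have hm : 0 < m := lt_of_le_of_ne (hF a) (Ne.symm ((hSmem a).1 haS))
  set G : V → ℝ := fun x => F x - if x ∈ S then m else 0 with hG
  have hGnn : ∀ x, 0 ≤ G x := fun x => by
    by_cases hx : x ∈ S
    · simpa [hG, hx] using ha x hx
    · simpa [hG, hx] using hF x
  have hF0 : ∀ x, x ∉ S → F x = 0 := fun x hx => by
    by_contra h'
    exact hx ((hSmem x).2 h')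
  have hsub : (Finset.univ.filter fun x => G x ≠ 0) ⊆ S.erase a := by
    intro x hx
    have hx' : G x ≠ 0 := by simpa using hx
    rw [Finset.mem_erase]
    refine ⟨?_, ?_⟩
    · rintro rfl
      exact hx' (by simp [hG, haS, m])
    · by_contra hxS
      exact hx' (by simp [hG, hxS, hF0 x hxS])
  have hcard : (Finset.univ.filter fun x => G x ≠ 0).card < k := by
    rw [← hk]
    exact (Finset.card_le_card hsub).trans_lt (Finset.card_erase_lt_of_mem haS)
  have hGsupp : ∑ x with G x ≠ 0, p x ≤ 1 / 2 :=
    (Finset.sum_le_sum_of_subset_of_nonneg (hsub.trans (S.erase_subset a))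
      fun x _ _ => (hp x).le).trans hsupp
  have key := ih _ hcard G hGnn hGsupp rfl
  have hE : ∀ x y, W x y * |F x - F y| = W x y * |G x - G y|
      + m * ((if x ∈ S then if y ∈ Sᶜ then W x y else 0 else 0)
        + (if y ∈ S then if x ∈ Sᶜ then W x y else 0 else 0)) := by
    intro x y
    by_cases hx : x ∈ S <;> by_cases hy : y ∈ S
    · simp [hG, hx, hy]
    · have h1 := ha x hx
      have h2 := hF0 y hy
      simp only [hG, hx, hy, h2, Finset.mem_compl, if_true, if_false, not_false_eq_true, not_true,
        sub_zero]
      rw [abs_of_nonneg (hF x), abs_of_nonneg (sub_nonneg.2 h1)]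
      ring
    · have h1 := ha y hy
      have h2 := hF0 x hx
      simp only [hG, hx, hy, h2, Finset.mem_compl, if_true, if_false, not_false_eq_true, not_true,
        sub_zero, zero_sub, abs_neg]
      rw [abs_of_nonneg (hF y), abs_of_nonneg (sub_nonneg.2 h1)]
      ring
    · simp [hG, hx, hy]
  have hB1 : ∑ x, ∑ y, (if x ∈ S then if y ∈ Sᶜ then W x y else 0 else 0)
      = ∑ x ∈ S, ∑ y ∈ Sᶜ, W x y := by
    have : ∀ x, ∑ y, (if x ∈ S then if y ∈ Sᶜ then W x y else 0 else 0)
        = if x ∈ S then ∑ y ∈ Sᶜ, W x y else 0 := fun x => by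
      by_cases hx : x ∈ S
      · simp only [hx, if_true, Finset.sum_ite_mem, Finset.univ_inter]
      · simp [hx]
    simp only [this, Finset.sum_ite_mem, Finset.univ_inter]
  have hB2 : ∑ x, ∑ y, (if y ∈ S then if x ∈ Sᶜ then W x y else 0 else 0)
      = ∑ x ∈ S, ∑ y ∈ Sᶜ, W x y := by
    rw [Finset.sum_comm, ← hB1]
    refine Finset.sum_congr rfl fun x _ => Finset.sum_congr rfl fun y _ => ?_
    rw [hWs x y]
  have hR : ∑ x, ∑ y, W x y * |F x - F y| = ∑ x, ∑ y, W x y * |G x - G y|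
      + m * (2 * ∑ x ∈ S, ∑ y ∈ Sᶜ, W x y) := by
    simp only [hE, Finset.sum_add_distrib, ← Finset.mul_sum, hB1, hB2]
    ring
  have hL : ∑ x, p x * F x = ∑ x, p x * G x + m * ∑ x ∈ S, p x := by
    have : ∀ x, p x * F x = p x * G x + m * (if x ∈ S then p x else 0) := fun x => by
      by_cases hx : x ∈ S
      · simp only [hG, hx, if_true]
        ring
      · simp [hG, hx]
    simp only [this, Finset.sum_add_distrib, ← Finset.mul_sum, Finset.sum_ite_mem,
      Finset.univ_inter]
  rw [hR, hL]
  have := mul_le_mul_of_nonneg_left (hiso S hsupp) hm.le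
  linarith

/-- Cheeger's inequality for functions supported on a set of measure at most `1/2`. -/
theorem cheeger_of_support {p : V → ℝ} {W : V → V → ℝ} {h : ℝ} (hWs : ∀ x y, W x y = W y x)
    (hW : ∀ x y, 0 ≤ W x y) (hrow : ∀ x, ∑ y, W x y ≤ p x / 2) (hp : ∀ x, 0 < p x) (hh : 0 ≤ h)
    (hiso : ∀ S : Finset V, ∑ x ∈ S, p x ≤ 1 / 2 →
      h * ∑ x ∈ S, p x ≤ ∑ x ∈ S, ∑ y ∈ Sᶜ, W x y)
    (u : V → ℝ) (hsupp : ∑ x with u x ≠ 0, p x ≤ 1 / 2) :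
    h ^ 2 * ∑ x, p x * u x ^ 2 ≤ 1 / 2 * ∑ x, ∑ y, W x y * (u x - u y) ^ 2 := by
  have hco := coarea_le hWs hp hiso (fun x => u x ^ 2) (fun x => sq_nonneg _) (by simpa using hsupp)
  set N := ∑ x, p x * u x ^ 2 with hN
  have hN0 : 0 ≤ N := Finset.sum_nonneg fun x _ => mul_nonneg (hp x).le (sq_nonneg _)
  have hE0 : 0 ≤ ∑ x, ∑ y, W x y * (u x - u y) ^ 2 :=
    Finset.sum_nonneg fun x _ => Finset.sum_nonneg fun y _ => mul_nonneg (hW x y) (sq_nonneg _)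
  have hCS : (∑ x, ∑ y, W x y * |u x ^ 2 - u y ^ 2|) ^ 2
      ≤ (∑ x, ∑ y, W x y * (u x - u y) ^ 2) * ∑ x, ∑ y, W x y * (u x + u y) ^ 2 := by
    simp only [← Fintype.sum_prod_type']
    refine Finset.sum_sq_le_sum_mul_sum_of_sq_le_mul _ (fun i _ => ?_) (fun i _ => ?_)
      (fun i _ => ?_)
    · exact mul_nonneg (hW _ _) (sq_nonneg _)
    · exact mul_nonneg (hW _ _) (sq_nonneg _)
    · rw [mul_pow, sq_abs]
      exact le_of_eq (by ring)
  have hplus : ∑ x, ∑ y, W x y * (u x + u y) ^ 2 ≤ 2 * N := by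
    have h1 : ∑ x, ∑ y, W x y * u x ^ 2 ≤ N / 2 := by
      rw [hN, Finset.sum_div]
      refine Finset.sum_le_sum fun x _ => ?_
      rw [← Finset.sum_mul]
      have := mul_le_mul_of_nonneg_right (hrow x) (sq_nonneg (u x))
      linarith
    have h2 : ∑ x, ∑ y, W x y * u y ^ 2 = ∑ x, ∑ y, W x y * u x ^ 2 := by
      rw [Finset.sum_comm]
      refine Finset.sum_congr rfl fun x _ => Finset.sum_congr rfl fun y _ => ?_
      rw [hWs x y]
    calc ∑ x, ∑ y, W x y * (u x + u y) ^ 2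
        ≤ ∑ x, ∑ y, (2 * (W x y * u x ^ 2) + 2 * (W x y * u y ^ 2)) := by
          refine Finset.sum_le_sum fun x _ => Finset.sum_le_sum fun y _ => ?_
          nlinarith [mul_nonneg (hW x y) (sq_nonneg (u x - u y))]
      _ = 2 * ∑ x, ∑ y, W x y * u x ^ 2 + 2 * ∑ x, ∑ y, W x y * u y ^ 2 := by
          simp only [Finset.sum_add_distrib, ← Finset.mul_sum]
      _ ≤ 2 * N := by rw [h2]; linarith
  rcases hN0.eq_or_lt with h0 | hpos
  · rw [← h0, mul_zero]
    positivity
  have h3 : (h * N) ^ 2 ≤ (1 / 2 * ∑ x, ∑ y, W x y * |u x ^ 2 - u y ^ 2|) ^ 2 :=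
    pow_le_pow_left₀ (mul_nonneg hh hN0) hco 2
  have h4 := mul_le_mul_of_nonneg_left hplus hE0
  refine le_of_mul_le_mul_right ?_ hpos
  nlinarith

/-- Every function on a finite probability space has a median. -/
theorem exists_median [Nonempty V] {p : V → ℝ} (hp : ∀ x, 0 < p x) (hp1 : ∑ x, p x = 1)
    (f : V → ℝ) : ∃ m, ∑ x with m < f x, p x ≤ 1 / 2 ∧ ∑ x with f x < m, p x ≤ 1 / 2 := by
  obtain ⟨b, hb⟩ := Finite.exists_max f
  set T : Finset V := Finset.univ.filter fun a => ∑ x with f a < f x, p x ≤ 1 / 2 with hT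
  have hTne : T.Nonempty := ⟨b, by
    have : (Finset.univ.filter fun x => f b < f x) = ∅ := by
      ext x
      simpa using hb x
    simp [hT, this]⟩
  obtain ⟨a, haT, ha⟩ := T.exists_min_image f hTne
  refine ⟨f a, by simpa [hT] using haT, ?_⟩
  rcases (Finset.univ.filter fun x => f x < f a).eq_empty_or_nonempty with h0 | hne
  · simp [h0]
  obtain ⟨c, hcm, hc⟩ := Finset.exists_max_image _ f hne
  have hca : f c < f a := by simpa using hcm
  have hcT : c ∉ T := fun h => (ha c h).not_gt hca
  have h1 : 1 / 2 < ∑ x with f c < f x, p x := by simpa [hT] using hcT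
  have h2 : Disjoint (Finset.univ.filter fun x => f x < f a)
      (Finset.univ.filter fun x => f c < f x) := by
    rw [Finset.disjoint_left]
    intro x hx hx'
    have := hc x hx
    have hx'' : f c < f x := by simpa using hx'
    exact this.not_gt hx''
  have h3 : ∑ x ∈ (Finset.univ.filter fun x => f x < f a) ∪
      (Finset.univ.filter fun x => f c < f x), p x ≤ ∑ x, p x :=
    Finset.sum_le_sum_of_subset_of_nonneg (Finset.subset_univ _) fun x _ _ => (hp x).le
  rw [Finset.sum_union h2, hp1] at h3
  linarith

/-- Cheeger's inequality for mean-zero functions, for weights with row sums at most `p / 2`. -/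
theorem cheeger [Nonempty V] {p : V → ℝ} {W : V → V → ℝ} {h : ℝ} (hWs : ∀ x y, W x y = W y x)
    (hW : ∀ x y, 0 ≤ W x y) (hrow : ∀ x, ∑ y, W x y ≤ p x / 2) (hp : ∀ x, 0 < p x)
    (hp1 : ∑ x, p x = 1) (hh : 0 ≤ h)
    (hiso : ∀ S : Finset V, ∑ x ∈ S, p x ≤ 1 / 2 →
      h * ∑ x ∈ S, p x ≤ ∑ x ∈ S, ∑ y ∈ Sᶜ, W x y)
    (f : V → ℝ) (hf : ∑ x, p x * f x = 0) :
    h ^ 2 * ∑ x, p x * f x ^ 2 ≤ 1 / 2 * ∑ x, ∑ y, W x y * (f x - f y) ^ 2 := by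
  obtain ⟨m, hm1, hm2⟩ := exists_median hp hp1 f
  have hu := cheeger_of_support hWs hW hrow hp hh hiso (fun x => max (f x - m) 0)
    (by simpa using hm1)
  have hv := cheeger_of_support hWs hW hrow hp hh hiso (fun x => max (m - f x) 0)
    (by simpa using hm2)
  have hsq : ∀ x, max (f x - m) 0 ^ 2 + max (m - f x) 0 ^ 2 = (f x - m) ^ 2 := fun x => by
    rcases le_total (f x) m with hx | hx
    · rw [max_eq_right (by linarith), max_eq_left (by linarith)]; ring
    · rw [max_eq_left (by linarith), max_eq_right (by linarith)]; ring
  have hN : ∑ x, p x * max (f x - m) 0 ^ 2 + ∑ x, p x * max (m - f x) 0 ^ 2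
      = ∑ x, p x * f x ^ 2 + m ^ 2 := by
    rw [← Finset.sum_add_distrib]
    have : ∀ x, p x * max (f x - m) 0 ^ 2 + p x * max (m - f x) 0 ^ 2
        = p x * f x ^ 2 + m ^ 2 * p x - 2 * m * (p x * f x) := fun x => by
      rw [← mul_add, hsq]; ring
    simp only [this, Finset.sum_add_distrib, Finset.sum_sub_distrib, ← Finset.mul_sum, hf, hp1]
    ring
  have hE : ∑ x, ∑ y, W x y * (max (f x - m) 0 - max (f y - m) 0) ^ 2
      + ∑ x, ∑ y, W x y * (max (m - f x) 0 - max (m - f y) 0) ^ 2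
      ≤ ∑ x, ∑ y, W x y * (f x - f y) ^ 2 := by
    simp only [← Finset.sum_add_distrib, ← mul_add]
    refine Finset.sum_le_sum fun x _ => Finset.sum_le_sum fun y _ =>
      mul_le_mul_of_nonneg_left ?_ (hW x y)
    rcases le_total (f x) m with hx | hx <;> rcases le_total (f y) m with hy | hy
    · rw [max_eq_right (by linarith), max_eq_right (by linarith : f y - m ≤ 0),
        max_eq_left (by linarith), max_eq_left (by linarith)]
      nlinarith
    · rw [max_eq_right (by linarith), max_eq_left (by linarith : 0 ≤ f y - m),
        max_eq_left (by linarith), max_eq_right (by linarith)]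
      nlinarith
    · rw [max_eq_left (by linarith), max_eq_right (by linarith : f y - m ≤ 0),
        max_eq_right (by linarith), max_eq_left (by linarith)]
      nlinarith
    · rw [max_eq_left (by linarith), max_eq_left (by linarith : 0 ≤ f y - m),
        max_eq_right (by linarith), max_eq_right (by linarith)]
      nlinarith
  have : 0 ≤ h ^ 2 * m ^ 2 := by positivity
  calc h ^ 2 * ∑ x, p x * f x ^ 2
      ≤ h ^ 2 * (∑ x, p x * max (f x - m) 0 ^ 2 + ∑ x, p x * max (m - f x) 0 ^ 2) := by
        rw [hN]; linarith
    _ ≤ _ := by linarith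

/-- One-step `L²` contraction of densities for a lazy chain moving `p` to `q`. -/
theorem l2_contraction [Nonempty V] {p q : V → ℝ} {P : V → V → ℝ} {g φ : ℝ}
    (hp : ∀ x, 0 < p x) (hp1 : ∑ x, p x = 1) (hq : ∀ x, 0 < q x)
    (hP0 : ∀ x y, 0 ≤ P x y) (hP1 : ∀ x, ∑ y, P x y = 1) (hlazy : ∀ x, 1 / 2 ≤ P x x)
    (hpq : ∀ y, ∑ x, p x * P x y = q y) (hg : 0 ≤ g) (hgq : ∀ x, g * q x ≤ p x) (hφ : 0 ≤ φ)
    (hiso : ∀ S : Finset V, ∑ x ∈ S, p x ≤ 1 / 2 → φ * (2 * ∑ x ∈ S, p x) ≤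
      ∑ x ∈ S, ∑ y ∈ Sᶜ, p x * P x y + ∑ x ∈ Sᶜ, ∑ y ∈ S, p x * P x y)
    (f : V → ℝ) (hf : ∑ x, p x * f x = 0) :
    ∑ y, q y * ((∑ x, p x * P x y * f x) / q y) ^ 2
      ≤ (1 - (g * φ) ^ 2) * ∑ x, p x * f x ^ 2 := by
  set W : V → V → ℝ := fun x y => if x = y then 0 else g / 2 * (p x * P x y + p y * P y x) with hWd
  have hQ0 : ∀ x y, 0 ≤ p x * P x y := fun x y => mul_nonneg (hp x).le (hP0 x y)
  have hWs : ∀ x y, W x y = W y x := fun x y => by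
    simp only [hWd, eq_comm (a := x), add_comm (p x * P x y)]
  have hW : ∀ x y, 0 ≤ W x y := fun x y => by
    simp only [hWd]
    split_ifs
    · exact le_rfl
    · have := hQ0 x y
      have := hQ0 y x
      positivity
  have hrow : ∀ x, ∑ y, W x y ≤ p x / 2 := fun x => by
    have h1 : ∀ y, W x y = g / 2 * (p x * P x y + p y * P y x)
        - if x = y then g / 2 * (p x * P x x + p x * P x x) else 0 := fun y => by
      simp only [hWd]
      split_ifs with hxy
      · subst hxy; ring
      · ring
    simp only [h1, Finset.sum_sub_distrib, ← Finset.mul_sum, Finset.sum_add_distrib, hP1, hpq,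
      Finset.sum_ite_eq, Finset.mem_univ, if_true]
    have h2 := hgq x
    have h3 : 0 ≤ g * (p x * (2 * P x x - 1)) :=
      mul_nonneg hg (mul_nonneg (hp x).le (by linarith [hlazy x]))
    nlinarith
  have hWiso : ∀ S : Finset V, ∑ x ∈ S, p x ≤ 1 / 2 →
      g * φ * ∑ x ∈ S, p x ≤ ∑ x ∈ S, ∑ y ∈ Sᶜ, W x y := fun S hS => by
    have h1 : ∑ x ∈ S, ∑ y ∈ Sᶜ, W x y = g / 2 * (∑ x ∈ S, ∑ y ∈ Sᶜ, p x * P x y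
        + ∑ x ∈ Sᶜ, ∑ y ∈ S, p x * P x y) := by
      rw [Finset.sum_comm (s := Sᶜ), ← Finset.sum_add_distrib, Finset.mul_sum]
      refine Finset.sum_congr rfl fun x hx => ?_
      rw [← Finset.sum_add_distrib, Finset.mul_sum]
      refine Finset.sum_congr rfl fun y hy => ?_
      have hxy : x ≠ y := by
        rintro rfl
        exact (Finset.mem_compl.1 hy) hx
      simp [hWd, hxy]
    rw [h1]
    have := mul_le_mul_of_nonneg_left (hiso S hS) (by positivity : 0 ≤ g / 2)
    linarith
  have hch := cheeger hWs hW hrow hp hp1 (mul_nonneg hg hφ) hWiso f hf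
  set K : V → V → ℝ := fun x x' => ∑ y, p x * P x y * (p x' * P x' y) / q y with hK
  have hterm : ∀ x x' y, 0 ≤ p x * P x y * (p x' * P x' y) / q y := fun x x' y =>
    div_nonneg (mul_nonneg (hQ0 _ _) (hQ0 _ _)) (hq y).le
  have hWK : ∀ x x', W x x' ≤ K x x' := fun x x' => by
    by_cases hxx : x = x'
    · simpa [hWd, hxx] using Finset.sum_nonneg fun y _ => hterm x' x' y
    have h1 : ∑ y ∈ {x, x'}, p x * P x y * (p x' * P x' y) / q y ≤ K x x' :=
      Finset.sum_le_sum_of_subset_of_nonneg (Finset.subset_univ _) fun y _ _ => hterm x x' y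
    rw [Finset.sum_pair hxx] at h1
    have hdiag : ∀ z, g / 2 ≤ p z * P z z / q z := fun z => by
      rw [le_div_iff₀ (hq z)]
      have := hgq z
      have := mul_le_mul_of_nonneg_left (hlazy z) (hp z).le
      linarith
    have h2 := mul_le_mul_of_nonneg_right (hdiag x) (hQ0 x' x)
    have h3 := mul_le_mul_of_nonneg_right (hdiag x') (hQ0 x x')
    simp only [hWd, if_neg hxx]
    calc g / 2 * (p x * P x x' + p x' * P x' x)
        ≤ p x * P x x / q x * (p x' * P x' x) + p x' * P x' x' / q x' * (p x * P x x') := by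
          linarith
      _ = _ := by ring
      _ ≤ _ := h1
  have hKs : ∀ x x', K x x' = K x' x := fun x x' =>
    Finset.sum_congr rfl fun y _ => by rw [mul_comm (p x * P x y)]
  have hKrow : ∀ x, ∑ x', K x x' = p x := fun x => by
    simp only [hK]
    rw [Finset.sum_comm]
    have : ∀ y, ∑ x', p x * P x y * (p x' * P x' y) / q y = p x * P x y := fun y => by
      rw [← Finset.sum_div, ← Finset.mul_sum, hpq, mul_div_assoc, div_self (hq y).ne', mul_one]
    simp only [this, ← Finset.mul_sum, hP1, mul_one]
  have hquad : ∑ y, q y * ((∑ x, p x * P x y * f x) / q y) ^ 2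
      = ∑ x, ∑ x', K x x' * (f x * f x') := by
    have h1 : ∀ y, q y * ((∑ x, p x * P x y * f x) / q y) ^ 2
        = ∑ x, ∑ x', p x * P x y * (p x' * P x' y) / q y * (f x * f x') := fun y => by
      have : q y * ((∑ x, p x * P x y * f x) / q y) ^ 2
          = (∑ x, p x * P x y * f x) * (∑ x', p x' * P x' y * f x') / q y := by
        have := (hq y).ne'
        field_simp
      rw [this, Finset.sum_mul_sum, Finset.sum_div]
      refine Finset.sum_congr rfl fun x _ => ?_
      rw [Finset.sum_div]
      exact Finset.sum_congr rfl fun x' _ => by ring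
    simp only [h1, hK, Finset.sum_mul]
    rw [Finset.sum_comm]
    exact Finset.sum_congr rfl fun x _ => Finset.sum_comm
  have hdir : ∑ x, ∑ x', K x x' * (f x - f x') ^ 2
      = 2 * ∑ x, p x * f x ^ 2 - 2 * ∑ x, ∑ x', K x x' * (f x * f x') := by
    have h1 : ∑ x, ∑ x', K x x' * f x ^ 2 = ∑ x, p x * f x ^ 2 := by
      simp only [← Finset.sum_mul, hKrow]
    have h2 : ∑ x, ∑ x', K x x' * f x' ^ 2 = ∑ x, p x * f x ^ 2 := by
      rw [← h1, Finset.sum_comm]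
      refine Finset.sum_congr rfl fun x _ => Finset.sum_congr rfl fun y _ => ?_
      rw [hKs x y]
    have h3 : ∀ x x', K x x' * (f x - f x') ^ 2
        = K x x' * f x ^ 2 + K x x' * f x' ^ 2 - 2 * (K x x' * (f x * f x')) := fun x x' => by ring
    simp only [h3, Finset.sum_sub_distrib, Finset.sum_add_distrib, ← Finset.mul_sum, h1, h2]
    ring
  have hcmp : ∑ x, ∑ x', W x x' * (f x - f x') ^ 2 ≤ ∑ x, ∑ x', K x x' * (f x - f x') ^ 2 :=
    Finset.sum_le_sum fun x _ => Finset.sum_le_sum fun x' _ =>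
      mul_le_mul_of_nonneg_right (hWK x x') (sq_nonneg _)
  rw [hquad]
  linarith

end Cheeger

theorem mprod_self (n : ℕ) (P : ℤ → Matrix (Fin n) (Fin n) ℝ) (s : ℤ) : mprod n P s s = 1 := by
  simp [mprod]

theorem mprod_succ (n : ℕ) (P : ℤ → Matrix (Fin n) (Fin n) ℝ) {s t : ℤ} (hst : s ≤ t) :
    mprod n P s (t + 1) = mprod n P s t * P (t + 1) := by
  have h1 : (t + 1 - s).toNat = (t - s).toNat + 1 := by omega
  have h2 : s + 1 + max (t - s) 0 = t + 1 := by omega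
  simp [mprod, h1, List.range_succ, h2]

/-- The target distributions are transported by the chain. -/
theorem IsTarget.step {n : ℕ} {P : ℤ → Matrix (Fin n) (Fin n) ℝ} {π : ℤ → Fin n → ℝ}
    (hn : 1 ≤ n) (hπ : IsTarget n P π) (t : ℤ) (y : Fin n) :
    ∑ x, π t x * P (t + 1) x y = π (t + 1) y := by
  have x₀ : Fin n := ⟨0, hn⟩
  have h1 : Tendsto (fun s : ℤ => ∑ x, mprod n P s t x₀ x * P (t + 1) x y) atBot
      (nhds (∑ x, π t x * P (t + 1) x y)) :=
    tendsto_finsetSum _ fun x _ => ((hπ t).2.2 x₀ x).mul_const _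
  refine tendsto_nhds_unique (h1.congr' ?_) ((hπ (t + 1)).2.2 x₀ y)
  filter_upwards [eventually_le_atBot t] with s hs
  rw [mprod_succ n P hs, Matrix.mul_apply]

/-- The weighted `L²` distance to the target decays at each step by the bottleneck ratio. -/
theorem l2_dist_step {n : ℕ} (hn : 1 ≤ n) {P : ℤ → Matrix (Fin n) (Fin n) ℝ}
    (hP : ∀ s, (∀ x y, 0 ≤ P s x y) ∧ ∀ x, ∑ y, P s x y = 1)
    (hlazy : ∀ s x, (1 : ℝ) / 2 ≤ P s x x)
    {π : ℤ → Fin n → ℝ} (hπ : IsTarget n P π) (s : ℤ)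
    (h0 : ∀ z, 0 < π s z) (h1 : ∀ z, 0 < π (s + 1) z) (μ : Fin n → ℝ) (hμ : ∑ z, μ z = 1) :
    ∑ y, π (s + 1) y * ((∑ x, μ x * P (s + 1) x y) / π (s + 1) y - 1) ^ 2
      ≤ (1 - ((1 / 2) * (gq n π (s + 1) / (1 - gq n π (s + 1) / 2)) *
          bigPhiStar n P π (s + 1)) ^ 2) * ∑ x, π s x * (μ x / π s x - 1) ^ 2 := by
  have : Nonempty (Fin n) := ⟨⟨0, hn⟩⟩
  have hs : s + 1 - 1 = s := by ring
  set g := gq n π (s + 1) with hgdef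
  set φ := bigPhiStar n P π (s + 1)
  have hg0 : 0 ≤ g := by
    refine le_ciInf fun z => ?_
    rw [hs]
    exact (div_pos (h0 z) (h1 z)).le
  have hgq : ∀ z, g * π (s + 1) z ≤ π s z := fun z => by
    have : g ≤ π s z / π (s + 1) z := by
      rw [hgdef, gq, hs]
      exact ciInf_le (Set.finite_range fun z => π s z / π (s + 1) z).bddBelow z
    rwa [le_div_iff₀ (h1 z)] at this
  have hg1 : g ≤ 1 := by
    have := Finset.sum_le_sum fun z (_ : z ∈ Finset.univ) => hgq z
    rwa [← Finset.mul_sum, (hπ s).2.1, (hπ (s + 1)).2.1, mul_one] at this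
  have hflow : ∀ A B, 0 ≤ flowQ n P π (s + 1) A B := fun A B =>
    Finset.sum_nonneg fun x _ => Finset.sum_nonneg fun y _ => by
      rw [hs]
      exact mul_nonneg (h0 x).le ((hP _).1 x y)
  have hΦ0 : ∀ r ∈ {r | ∃ S : Finset (Fin n), S.Nonempty ∧
      (∑ x ∈ S, π (s + 1 - 1) x) ≤ 1 / 2 ∧ r = bigPhi n P π (s + 1) S}, 0 ≤ r := by
    rintro r ⟨S, -, -, rfl⟩
    refine div_nonneg (add_nonneg (hflow _ _) (hflow _ _)) (mul_nonneg zero_le_two ?_)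
    rw [hs]
    exact Finset.sum_nonneg fun x _ => (h0 x).le
  have hφ0 : 0 ≤ φ := Real.sInf_nonneg hΦ0
  have hiso : ∀ S : Finset (Fin n), ∑ x ∈ S, π s x ≤ 1 / 2 → φ * (2 * ∑ x ∈ S, π s x) ≤
      ∑ x ∈ S, ∑ y ∈ Sᶜ, π s x * P (s + 1) x y
        + ∑ x ∈ Sᶜ, ∑ y ∈ S, π s x * P (s + 1) x y := fun S hS => by
    rcases S.eq_empty_or_nonempty with rfl | hne
    · simp
    have hpos : 0 < 2 * ∑ x ∈ S, π s x :=
      mul_pos two_pos (Finset.sum_pos (fun x _ => h0 x) hne)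
    have hle : φ ≤ bigPhi n P π (s + 1) S :=
      csInf_le ⟨0, hΦ0⟩ ⟨S, hne, by rwa [hs], rfl⟩
    rw [bigPhi, hs, le_div_iff₀ hpos] at hle
    simpa only [flowQ, hs] using hle
  have hmean : ∑ x, π s x * (μ x / π s x - 1) = 0 := by
    have : ∀ x, π s x * (μ x / π s x - 1) = μ x - π s x := fun x => by
      have := (h0 x).ne'
      field_simp
    simp only [this, Finset.sum_sub_distrib, hμ, (hπ s).2.1, sub_self]
  have key := l2_contraction h0 (hπ s).2.1 h1 (hP (s + 1)).1 (hP (s + 1)).2 (hlazy (s + 1))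
    (hπ.step hn s) hg0 hgq hφ0 hiso _ hmean
  have hdens : ∀ y, (∑ x, π s x * P (s + 1) x y * (μ x / π s x - 1)) / π (s + 1) y
      = (∑ x, μ x * P (s + 1) x y) / π (s + 1) y - 1 := fun y => by
    have : ∀ x, π s x * P (s + 1) x y * (μ x / π s x - 1)
        = μ x * P (s + 1) x y - π s x * P (s + 1) x y := fun x => by
      have := (h0 x).ne'
      field_simp
    simp only [this, Finset.sum_sub_distrib, hπ.step hn s, sub_div, div_self (h1 y).ne']
  simp only [hdens] at key
  refine key.trans (mul_le_mul_of_nonneg_right ?_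
    (Finset.sum_nonneg fun x _ => mul_nonneg (h0 x).le (sq_nonneg _)))
  have hb : 1 / 2 * (g / (1 - g / 2)) ≤ g := by
    rw [← mul_div_assoc, div_le_iff₀ (by linarith)]
    nlinarith
  have hb0 : 0 ≤ 1 / 2 * (g / (1 - g / 2)) := by
    have : 0 < 1 - g / 2 := by linarith
    positivity
  have := pow_le_pow_left₀ (mul_nonneg hb0 hφ0) (mul_le_mul_of_nonneg_right hb hφ0) 2
  linarith

theorem mprod_row_sum {n : ℕ} {P : ℤ → Matrix (Fin n) (Fin n) ℝ}
    (hP : ∀ s x, ∑ y, P s x y = 1) (x : Fin n) (k : ℕ) : ∑ z, mprod n P 0 k x z = 1 := by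
  induction k with
  | zero => simp [mprod_self, Matrix.one_apply]
  | succ k ih =>
    simp only [Nat.cast_succ, mprod_succ n P (Int.natCast_nonneg k), Matrix.mul_apply]
    rw [Finset.sum_comm]
    simpa only [← Finset.mul_sum, hP, mul_one] using ih

/-- Exponential decay of the weighted `L²` distance to the target. -/
theorem l2_dist_le {n : ℕ} (hn : 1 ≤ n) {P : ℤ → Matrix (Fin n) (Fin n) ℝ}
    (hP : ∀ s, (∀ x y, 0 ≤ P s x y) ∧ ∀ x, ∑ y, P s x y = 1)
    (hlazy : ∀ s x, (1 : ℝ) / 2 ≤ P s x x)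
    {π : ℤ → Fin n → ℝ} (hπ : IsTarget n P π) {t : ℕ}
    (hπpos : ∀ s : ℤ, 0 ≤ s → s ≤ (t : ℤ) → ∀ z, 0 < π s z) (x : Fin n) (k : ℕ) (hk : k ≤ t) :
    ∑ z, π k z * (mprod n P 0 k x z / π k z - 1) ^ 2
      ≤ Real.exp (-(theta n P π t * k)) * (1 / π 0 x) := by
  induction k with
  | zero =>
    have h0 := hπpos 0 le_rfl (Int.natCast_nonneg t)
    have hterm : ∀ z, π 0 z * ((1 : Matrix (Fin n) (Fin n) ℝ) x z / π 0 z - 1) ^ 2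
        = (if x = z then 1 / π 0 z - 2 else 0) + π 0 z := fun z => by
      have := (h0 z).ne'
      by_cases hz : x = z
      · subst hz
        simp only [Matrix.one_apply_eq, if_true]
        field_simp
        ring
      · simp [hz, Matrix.one_apply_ne]
    simp only [Nat.cast_zero, mprod_self, hterm, Finset.sum_add_distrib, Finset.sum_ite_eq,
      Finset.mem_univ, if_true, (hπ 0).2.1, mul_zero, neg_zero, Real.exp_zero, one_mul]
    linarith
  | succ k ih =>
    have hk' : (k : ℤ) + 1 ≤ t := by exact_mod_cast hk
    have hstep := l2_dist_step hn hP hlazy hπ (k : ℤ)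
      (hπpos k (Int.natCast_nonneg k) (by omega)) (hπpos (k + 1) (by omega) hk')
      (mprod n P 0 k x) (mprod_row_sum (fun s => (hP s).2) x k)
    have hθ : theta n P π t ≤ ((1 / 2) * (gq n π (k + 1) / (1 - gq n π (k + 1) / 2)) *
        bigPhiStar n P π (k + 1)) ^ 2 := by
      refine csInf_le ⟨0, ?_⟩ ⟨k + 1, by omega, hk, by push_cast; rfl⟩
      rintro r ⟨s, -, -, rfl⟩
      exact sq_nonneg _
    simp only [Nat.cast_succ, mprod_succ n P (Int.natCast_nonneg k), Matrix.mul_apply]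
    have hexp := Real.one_sub_le_exp_neg (theta n P π t)
    calc _ ≤ _ := hstep
      _ ≤ Real.exp (-theta n P π t) * ∑ z, π k z * (mprod n P 0 k x z / π k z - 1) ^ 2 := by
          refine mul_le_mul_of_nonneg_right (by linarith) (Finset.sum_nonneg fun z _ => ?_)
          exact mul_nonneg ((hπ k).1 z) (sq_nonneg _)
      _ ≤ Real.exp (-theta n P π t) * (Real.exp (-(theta n P π t * k)) * (1 / π 0 x)) :=
          mul_le_mul_of_nonneg_left (ih (by omega)) (Real.exp_pos _).le
      _ = _ := by
          rw [← mul_assoc, ← Real.exp_add]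
          ring_nf

/-- Total variation is controlled by the weighted `L²` distance of densities. -/
theorem sq_sum_abs_sub_le {V : Type*} [Fintype V] {q : V → ℝ} (hq : ∀ z, 0 < q z)
    (hq1 : ∑ z, q z = 1) (μ : V → ℝ) :
    (∑ z, |μ z - q z|) ^ 2 ≤ ∑ z, q z * (μ z / q z - 1) ^ 2 := by
  have := Finset.sum_sq_le_sum_mul_sum_of_sq_le_mul Finset.univ (r := fun z => |μ z - q z|)
    (f := fun z => q z * (μ z / q z - 1) ^ 2) (g := q)
    (fun z _ => mul_nonneg (hq z).le (sq_nonneg _)) (fun z _ => (hq z).le) (fun z _ => by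
      have := (hq z).ne'
      rw [sq_abs]
      apply le_of_eq
      field_simp)
  rwa [hq1, mul_one] at this

/-- Corollary 3.7: if `Θ_t > 0` and
`t ≥ (2/Θ_t)[log(1/(2√(π_0^min π_t^min))) + log ε⁻¹]`, then `d(0,t) ≤ ε`. -/
theorem mixing_bound_theta (n : ℕ) (hn : 1 ≤ n)
    (P : ℤ → Matrix (Fin n) (Fin n) ℝ)
    (hP : ∀ s, (∀ x y, 0 ≤ P s x y) ∧ ∀ x, ∑ y, P s x y = 1)
    (hlazy : ∀ s x, (1 : ℝ) / 2 ≤ P s x x)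
    (π : ℤ → Fin n → ℝ) (hπ : IsTarget n P π)
    (t : ℕ) (ht : 0 < t)
    (hπpos : ∀ s : ℤ, 0 ≤ s → s ≤ (t : ℤ) → ∀ z, 0 < π s z)
    (ε : ℝ) (hε : ε ∈ Set.Ioo (0:ℝ) 1)
    (hΘ : 0 < theta n P π t)
    (hcond : (2 / theta n P π t) *
        (Real.log (1 / (2 * Real.sqrt ((⨅ z : Fin n, π 0 z) * (⨅ z : Fin n, π t z)))) +
          Real.log ε⁻¹) ≤ (t : ℝ)) :
    dTV n P π 0 t ≤ ε := by
  have : Nonempty (Fin n) := ⟨⟨0, hn⟩⟩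
  have hmin : ∀ s : ℤ, 0 ≤ s → s ≤ (t : ℤ) → 0 < ⨅ z, π s z := fun s h0 h1 => by
    obtain ⟨z, hz⟩ := exists_eq_ciInf_of_finite (f := π s)
    rw [← hz]
    exact hπpos s h0 h1 z
  have ht0 : (0 : ℤ) ≤ t := Int.natCast_nonneg t
  set a := ⨅ z, π 0 z
  set b := ⨅ z, π t z
  have ha0 : 0 < a := hmin 0 le_rfl ht0
  have hb0 : 0 < b := hmin t ht0 le_rfl
  have hb1 : b ≤ 1 := by
    have z : Fin n := ⟨0, hn⟩
    refine (ciInf_le (Set.finite_range _).bddBelow z).trans ?_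
    rw [← (hπ t).2.1]
    exact Finset.single_le_sum (fun y _ => (hπ t).1 y) (Finset.mem_univ z)
  set θ := theta n P π t
  have hab : 0 < Real.sqrt (a * b) := Real.sqrt_pos.2 (mul_pos ha0 hb0)
  have hε0 := hε.1
  have hexp : Real.exp (-(θ * t)) ≤ (2 * Real.sqrt (a * b) * ε) ^ 2 := by
    have h1 : Real.log (1 / (2 * Real.sqrt (a * b))) + Real.log ε⁻¹
        = -Real.log (2 * Real.sqrt (a * b) * ε) := by
      rw [one_div, Real.log_inv, Real.log_inv, Real.log_mul (by positivity) hε0.ne']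
      ring
    rw [h1, div_mul_eq_mul_div, div_le_iff₀ hΘ] at hcond
    rw [← Real.le_log_iff_exp_le (by positivity), Real.log_pow]
    push_cast
    linarith
  refine ciSup_le fun x => ?_
  have hTV := sq_sum_abs_sub_le (hπpos t ht0 le_rfl) (hπ t).2.1 (mprod n P 0 t x)
  have hL2 := l2_dist_le hn hP hlazy hπ hπpos x t le_rfl
  have hx0 := hπpos 0 le_rfl ht0 x
  have hax : 1 / π 0 x ≤ 1 / a :=
    one_div_le_one_div_of_le ha0 (ciInf_le (Set.finite_range _).bddBelow x)
  have hsq : (∑ z, |mprod n P 0 t x z - π t z|) ^ 2 ≤ (2 * ε) ^ 2 :=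
    calc _ ≤ _ := hTV
      _ ≤ _ := hL2
      _ ≤ (2 * Real.sqrt (a * b) * ε) ^ 2 * (1 / a) := by gcongr
      _ = (2 * ε) ^ 2 * b := by
          rw [mul_pow, mul_pow, Real.sq_sqrt (by positivity)]
          field_simp
      _ ≤ (2 * ε) ^ 2 := mul_le_of_le_one_right (sq_nonneg _) hb1
  have := abs_le_of_sq_le_sq' hsq (by positivity)
  linarith [this.2]
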